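/- Let ρ, σ be positive definite 2×2 complex matrices with ρ·σ ≠ σ·ρ, and let α ∈ (0,1). Then inf { α·D^{max}(ω‖ρ) + (1−α)·D^{max}(ω‖σ) : ω a 2×2 state } < − log Tr(σ #_α ρ); in particular, there exists a state ω with α·D^{max}(ω‖ρ) + (1−α)·D^{max}(ω‖σ) < − log Tr(σ #_α ρ). (Equivalently, the barycentric Rényi α-divergence D_α^{b,max}(ρ‖σ) generated by the maximal relative entropy is strictly smaller than the maximal Rényi α-divergence D_α^{max}(ρ‖σ) := (1/(α−1))·(log Tr(σ #_α ρ) − log Tr ρ).) -/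

import Mathlib

open Matrix
open scoped ComplexOrder

/-- Functional calculus for Hermitian matrices: apply `f : ℝ → ℝ` to the eigenvalues
in a spectral decomposition (and return `0` on non-Hermitian input). -/
noncomputable def mfun {ι : Type*} [Fintype ι] [DecidableEq ι]
    (f : ℝ → ℝ) (A : Matrix ι ι ℂ) : Matrix ι ι ℂ :=
  letI := Classical.propDecidable A.IsHermitian
  if hA : A.IsHermitian then hA.cfc f else 0

/-- Real matrix power `A ^ γ` via functional calculus (with `Real.rpow` on eigenvalues,
so that `0 ^ γ = 0` for `γ ≠ 0`, giving the generalized inverse for `γ = -1`). -/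
noncomputable def mpow {ι : Type*} [Fintype ι] [DecidableEq ι]
    (A : Matrix ι ι ℂ) (γ : ℝ) : Matrix ι ι ℂ :=
  mfun (fun x => x ^ γ) A

/-- The `γ`-weighted geometric mean
`σ #_γ ρ := σ^{1/2} · (σ^{-1/2} · ρ · σ^{-1/2})^γ · σ^{1/2}`. -/
noncomputable def geomMean {ι : Type*} [Fintype ι] [DecidableEq ι]
    (σ ρ : Matrix ι ι ℂ) (γ : ℝ) : Matrix ι ι ℂ :=
  mpow σ (1 / 2) * mpow (mpow σ (-(1 / 2)) * ρ * mpow σ (-(1 / 2))) γ * mpow σ (1 / 2)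

/-- The Belavkin-Staszewski (maximal) relative entropy
`D^max(ω‖τ) := Tr[ω · nlog(ω^{1/2} · τ⁻¹ · ω^{1/2})]` of a nonzero PSD matrix `ω`
relative to a positive definite matrix `τ` (note `Real.log 0 = 0`, so `mfun Real.log`
implements `nlog`, and `mpow τ (-1)` is the inverse of a positive definite `τ`). -/
noncomputable def Dmax {ι : Type*} [Fintype ι] [DecidableEq ι]
    (ω τ : Matrix ι ι ℂ) : ℝ :=
  ((ω * mfun Real.log (mpow ω (1 / 2) * mpow τ (-1) * mpow ω (1 / 2))).trace).re

section FunctionalCalculus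

variable {ι : Type*} [Fintype ι] [DecidableEq ι]

lemma mfun_eq_cfc {A : Matrix ι ι ℂ} (hA : A.IsHermitian) (f : ℝ → ℝ) : mfun f A = cfc f A := by
  rw [mfun, dif_pos hA, hA.cfc_eq]

lemma isHermitian_mfun (A : Matrix ι ι ℂ) (f : ℝ → ℝ) : (mfun f A).IsHermitian := by
  by_cases hA : A.IsHermitian
  · rw [mfun_eq_cfc hA]
    exact cfc_predicate f A
  · rw [mfun, dif_neg hA]
    exact Matrix.isHermitian_zero

lemma continuousOn_real_spectrum (A : Matrix ι ι ℂ) (f : ℝ → ℝ) :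
    ContinuousOn f (spectrum ℝ A) :=
  A.finite_real_spectrum.continuousOn f

lemma mfun_mul {A : Matrix ι ι ℂ} (hA : A.IsHermitian) (f g : ℝ → ℝ) :
    mfun f A * mfun g A = mfun (fun x => f x * g x) A := by
  rw [mfun_eq_cfc hA, mfun_eq_cfc hA, mfun_eq_cfc hA,
    cfc_mul f g A (continuousOn_real_spectrum A f) (continuousOn_real_spectrum A g)]

lemma mfun_add {A : Matrix ι ι ℂ} (hA : A.IsHermitian) (f g : ℝ → ℝ) :
    mfun f A + mfun g A = mfun (fun x => f x + g x) A := by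
  rw [mfun_eq_cfc hA, mfun_eq_cfc hA, mfun_eq_cfc hA,
    cfc_add A f g (continuousOn_real_spectrum A f) (continuousOn_real_spectrum A g)]

lemma mfun_congr {A : Matrix ι ι ℂ} (hA : A.IsHermitian) {f g : ℝ → ℝ}
    (h : ∀ x ∈ spectrum ℝ A, f x = g x) : mfun f A = mfun g A := by
  rw [mfun_eq_cfc hA, mfun_eq_cfc hA]
  exact cfc_congr h

lemma mfun_id {A : Matrix ι ι ℂ} (hA : A.IsHermitian) : mfun (fun x => x) A = A := by
  rw [mfun_eq_cfc hA]
  exact cfc_id' ℝ A hA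

lemma mfun_const {A : Matrix ι ι ℂ} (hA : A.IsHermitian) (c : ℝ) :
    mfun (fun _ => c) A = (c : ℂ) • 1 := by
  rw [mfun_eq_cfc hA]
  refine (cfc_const c A hA).trans ?_
  rw [Algebra.algebraMap_eq_smul_one]
  ext i j
  simp

lemma mfun_eval {A : Matrix ι ι ℂ} (hA : A.IsHermitian) (p : Polynomial ℝ) :
    mfun (fun x => p.eval x) A = Polynomial.aeval A p := by
  rw [mfun_eq_cfc hA]
  exact cfc_polynomial p A hA

lemma spectrum_nonneg_of_posSemidef {A : Matrix ι ι ℂ} (hA : A.PosSemidef) {x : ℝ}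
    (hx : x ∈ spectrum ℝ A) : 0 ≤ x := by
  rw [hA.1.spectrum_real_eq_range_eigenvalues] at hx
  obtain ⟨i, rfl⟩ := hx
  exact hA.eigenvalues_nonneg i

lemma spectrum_pos_of_posDef {A : Matrix ι ι ℂ} (hA : A.PosDef) {x : ℝ}
    (hx : x ∈ spectrum ℝ A) : 0 < x := by
  rw [hA.1.spectrum_real_eq_range_eigenvalues] at hx
  obtain ⟨i, rfl⟩ := hx
  exact hA.eigenvalues_pos i

lemma mpow_mul_mpow {A : Matrix ι ι ℂ} (hA : A.PosDef) (a b : ℝ) :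
    mpow A a * mpow A b = mpow A (a + b) := by
  rw [mpow, mpow, mfun_mul hA.1]
  exact mfun_congr hA.1 fun x hx => (Real.rpow_add (spectrum_pos_of_posDef hA hx) a b).symm

lemma mpow_zero {A : Matrix ι ι ℂ} (hA : A.PosDef) : mpow A 0 = 1 := by
  simpa [mpow] using mfun_const hA.1 1

lemma mpow_one {A : Matrix ι ι ℂ} (hA : A.IsHermitian) : mpow A 1 = A := by
  simpa [mpow] using mfun_id hA

lemma mpow_neg_one {A : Matrix ι ι ℂ} (hA : A.PosDef) : mpow A (-1) = A⁻¹ := by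
  refine (Matrix.inv_eq_left_inv ?_).symm
  nth_rewrite 2 [← mpow_one hA.1]
  rw [mpow_mul_mpow hA, neg_add_cancel, mpow_zero hA]

lemma mpow_half_mul_self {A : Matrix ι ι ℂ} (hA : A.PosSemidef) :
    mpow A (1 / 2) * mpow A (1 / 2) = A := by
  rw [mpow, mfun_mul hA.1]
  nth_rewrite 2 [← mfun_id hA.1]
  refine mfun_congr hA.1 fun x hx => ?_
  rw [← Real.sqrt_eq_rpow]
  exact Real.mul_self_sqrt (spectrum_nonneg_of_posSemidef hA hx)

lemma aeval_conjTranspose_mul_self_mul (A : Matrix ι ι ℂ) (p : Polynomial ℝ) :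
    Polynomial.aeval (Aᴴ * A) p * Aᴴ = Aᴴ * Polynomial.aeval (A * Aᴴ) p := by
  induction p using Polynomial.induction_on with
  | C a => simp [Algebra.algebraMap_eq_smul_one]
  | add p q hp hq => simp [add_mul, mul_add, hp, hq]
  | monomial n a h =>
    simp only [pow_succ, ← mul_assoc, map_mul, Polynomial.aeval_X] at h ⊢
    rw [← h]

lemma mfun_conjTranspose_mul_self_mul (A : Matrix ι ι ℂ) (f : ℝ → ℝ) :
    mfun f (Aᴴ * A) * Aᴴ = Aᴴ * mfun f (A * Aᴴ) := by
  have h₁ := isHermitian_conjTranspose_mul_self A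
  have h₂ := isHermitian_mul_conjTranspose_self A
  let s : Finset ℝ :=
    (Aᴴ * A).finite_real_spectrum.toFinset ∪ (A * Aᴴ).finite_real_spectrum.toFinset
  have hs : ∀ x ∈ s, f x = (Lagrange.interpolate s id f).eval x := fun x hx =>
    (Lagrange.eval_interpolate_at_node f Function.injective_id.injOn hx).symm
  rw [mfun_congr h₁ (fun x hx => hs x (by simp [s, hx])),
    mfun_congr h₂ (fun x hx => hs x (by simp [s, hx])), mfun_eval h₁, mfun_eval h₂]
  exact aeval_conjTranspose_mul_self_mul A _

/-- The maximal relative entropy of `K * Y * Kᴴ` relative to `K * Kᴴ`. -/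
lemma Dmax_congruence {K Y : Matrix ι ι ℂ} (hK : IsUnit K) (hY : Y.PosSemidef) :
    Dmax (K * Y * Kᴴ) (K * Kᴴ) =
      (Kᴴ * K * mfun (fun x => x * Real.log x) Y).trace.re := by
  have hω : (K * Y * Kᴴ).PosSemidef := hY.mul_mul_conjTranspose_same K
  have hτ : (K * Kᴴ).PosDef := by
    simpa using Matrix.PosDef.one.mul_mul_conjTranspose_same
      (B := K) (Matrix.vecMul_injective_iff_isUnit.mpr hK)
  have hd : IsUnit K.det := (Matrix.isUnit_iff_isUnit_det K).mp hK
  have hdH : IsUnit Kᴴ.det := by rw [Matrix.det_conjTranspose]; exact hd.star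
  set ω := K * Y * Kᴴ with hωdef
  set R := mpow ω (1 / 2) with hR
  have hRR : R * R = ω := mpow_half_mul_self hω
  have hRH : Rᴴ = R := isHermitian_mfun _ _
  set A := K⁻¹ * R with hA
  have hAH : Aᴴ = R * Kᴴ⁻¹ := by rw [hA, conjTranspose_mul, hRH, conjTranspose_nonsing_inv]
  have hM : R * mpow (K * Kᴴ) (-1) * R = Aᴴ * A := by
    rw [mpow_neg_one hτ, Matrix.mul_inv_rev, hAH, hA]
    simp only [mul_assoc]
  have hAA : A * Aᴴ = Y := by
    calc A * Aᴴ = K⁻¹ * (R * R) * Kᴴ⁻¹ := by rw [hAH, hA]; simp only [mul_assoc]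
      _ = (K⁻¹ * K) * Y * (Kᴴ * Kᴴ⁻¹) := by rw [hRR, hωdef]; simp only [mul_assoc]
      _ = Y := by rw [Matrix.nonsing_inv_mul _ hd, Matrix.mul_nonsing_inv _ hdH, one_mul, mul_one]
  have hKA : K * A = R := by rw [hA, ← mul_assoc, Matrix.mul_nonsing_inv _ hd, one_mul]
  have hω' : ω = Aᴴ * (Kᴴ * K) * A := by
    calc ω = (K * A)ᴴ * (K * A) := by rw [hKA, hRH, hRR]
      _ = _ := by rw [conjTranspose_mul]; simp only [mul_assoc]
  have hlog : mfun (fun x => x * Real.log x) Y = Y * mfun Real.log Y := by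
    nth_rewrite 2 [← mfun_id hY.1]
    rw [mfun_mul hY.1]
  rw [Dmax, ← hR, hM, hlog]
  congr 1
  calc (ω * mfun Real.log (Aᴴ * A)).trace
      = (Aᴴ * ((Kᴴ * K) * (A * mfun Real.log (Aᴴ * A)))).trace := by
        rw [hω']; simp only [mul_assoc]
    _ = (Kᴴ * K * (A * (mfun Real.log (Aᴴ * A) * Aᴴ))).trace := by
        rw [Matrix.trace_mul_comm]; simp only [mul_assoc]
    _ = (Kᴴ * K * (Y * mfun Real.log Y)).trace := by
        rw [mfun_conjTranspose_mul_self_mul, ← mul_assoc A, hAA]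

lemma neg_trace_le_Dmax {ω τ : Matrix ι ι ℂ} (hω : ω.PosSemidef) (hτ : τ.PosDef) :
    -τ.trace.re ≤ Dmax ω τ := by
  set K := mpow τ (1 / 2) with hKdef
  have hKH : Kᴴ = K := isHermitian_mfun _ _
  have hKK : K * K = τ := mpow_half_mul_self hτ.posSemidef
  have hK : IsUnit K := isUnit_of_mul_isUnit_left (hKK ▸ hτ.isUnit)
  have hd : IsUnit K.det := (Matrix.isUnit_iff_isUnit_det K).mp hK
  have hY : (K⁻¹ * ω * K⁻¹ᴴ).PosSemidef := hω.mul_mul_conjTranspose_same K⁻¹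
  set Y := K⁻¹ * ω * K⁻¹ᴴ with hYdef
  have hωY : K * Y * Kᴴ = ω := by
    rw [hYdef, conjTranspose_nonsing_inv, hKH]
    calc K * (K⁻¹ * ω * K⁻¹) * K = (K * K⁻¹) * ω * (K⁻¹ * K) := by simp only [mul_assoc]
      _ = ω := by rw [Matrix.nonsing_inv_mul _ hd, Matrix.mul_nonsing_inv _ hd, one_mul, mul_one]
  have key := Dmax_congruence hK hY
  rw [hωY, hKH, hKK] at key
  have hpos : (mfun (fun x => x * Real.log x) Y + 1).PosSemidef := by
    have h : mfun (fun x => x * Real.log x) Y + 1 =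
        mfun (fun x => Real.sqrt (x * Real.log x + 1)) Y *
          (mfun (fun x => Real.sqrt (x * Real.log x + 1)) Y)ᴴ := by
      rw [isHermitian_mfun, mfun_mul hY.1]
      have h1 : (1 : Matrix ι ι ℂ) = mfun (fun _ => 1) Y := by simp [mfun_const hY.1]
      rw [h1, mfun_add hY.1]
      refine mfun_congr hY.1 fun x hx => (Real.mul_self_sqrt ?_).symm
      rcases (spectrum_nonneg_of_posSemidef hY hx).eq_or_lt with rfl | hx0
      · simp
      · have h2 := Real.one_sub_inv_le_log_of_pos hx0
        have h3 := mul_le_mul_of_nonneg_left h2 hx0.le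
        rw [mul_sub, mul_inv_cancel₀ hx0.ne'] at h3
        linarith
    rw [h]
    exact posSemidef_self_mul_conjTranspose _
  have htr := (hpos.mul_mul_conjTranspose_same K).trace_nonneg
  rw [hKH, Matrix.trace_mul_comm, ← mul_assoc, hKK, mul_add, mul_one, Matrix.trace_add] at htr
  have := (Complex.le_def.mp htr).1
  simp only [Complex.add_re, Complex.zero_re] at this
  linarith

end FunctionalCalculus

section TwoByTwo

lemma mfun_eq_of_mul_eq_zero {A : Matrix (Fin 2) (Fin 2) ℂ} (hA : A.IsHermitian) {l m : ℝ}
    (hlm : l ≠ m) (h : (A - (l : ℂ) • 1) * (A - (m : ℂ) • 1) = 0) (f : ℝ → ℝ) :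
    mfun f A = ((f m - (f l - f m) / (l - m) * m : ℝ) : ℂ) • 1 +
      (((f l - f m) / (l - m) : ℝ) : ℂ) • A := by
  have hsub (c : ℝ) : A - (c : ℂ) • 1 = mfun (fun x => x + -c) A := by
    rw [← mfun_add hA, mfun_id hA, mfun_const hA]
    simp [sub_eq_add_neg]
  have hspec : ∀ x ∈ spectrum ℝ A, x = l ∨ x = m := by
    intro x hx
    rw [hsub, hsub, mfun_mul hA, mfun_eq_cfc hA] at h
    have h1 := cfc_map_spectrum (R := ℝ) (fun x => (x + -l) * (x + -m)) A hA
      (continuousOn_real_spectrum A _)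
    rw [h, spectrum.zero_eq] at h1
    have h2 : (x + -l) * (x + -m) ∈ ({0} : Set ℝ) := h1 ▸ ⟨x, hx, rfl⟩
    rcases mul_eq_zero.mp h2 with h3 | h3
    · left; linarith
    · right; linarith
  have hlin (p q : ℝ) : (p : ℂ) • (1 : Matrix (Fin 2) (Fin 2) ℂ) + (q : ℂ) • A =
      mfun (fun x => p + q * x) A := by
    rw [← mfun_add hA, ← mfun_mul hA, mfun_id hA, mfun_const hA, mfun_const hA]
    simp
  rw [hlin]
  refine mfun_congr hA fun x hx => ?_
  have hne : l - m ≠ 0 := sub_ne_zero.mpr hlm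
  rcases hspec x hx with rfl | rfl
  · field_simp; ring
  · ring

/-- A line of Hermitian matrices through `diag(y₁, y₂)`. -/
noncomputable def hermLine (y₁ y₂ a : ℝ) (z : ℂ) (t : ℝ) : Matrix (Fin 2) (Fin 2) ℂ :=
  !![((y₁ + t * a : ℝ) : ℂ), t * z; t * star z, (y₂ : ℂ)]

lemma isHermitian_hermLine (y₁ y₂ a : ℝ) (z : ℂ) (t : ℝ) : (hermLine y₁ y₂ a z t).IsHermitian := by
  ext i j
  fin_cases i <;> fin_cases j <;> simp [hermLine]

lemma eventually_posSemidef_hermLine {y₁ y₂ : ℝ} (h₁ : 0 < y₁) (h₂ : 0 < y₂) (a : ℝ) (z : ℂ) :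
    ∀ᶠ t in nhds (0 : ℝ), (hermLine y₁ y₂ a z t).PosSemidef := by
  have hc : ContinuousAt (fun t : ℝ => y₁ + t * a - t ^ 2 * Complex.normSq z / y₂) 0 := by
    fun_prop
  have hev := hc.eventually (lt_mem_nhds (a := 0) (by simpa using h₁))
  filter_upwards [hev] with t ht
  have hdec : hermLine y₁ y₂ a z t =
      diagonal ![((y₁ + t * a - t ^ 2 * Complex.normSq z / y₂ : ℝ) : ℂ), 0] +
      ((y₂⁻¹ : ℝ) : ℂ) • vecMulVec ![(t : ℂ) * z, (y₂ : ℂ)] (star ![(t : ℂ) * z, (y₂ : ℂ)]) := by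
    have : (y₂ : ℂ) ≠ 0 := by exact_mod_cast h₂.ne'
    ext i j
    simp only [Matrix.add_apply, Matrix.smul_apply, vecMulVec_apply]
    fin_cases i <;> fin_cases j <;>
      simp [hermLine, Complex.normSq_eq_conj_mul_self] <;> field_simp
    ring
  rw [hdec]
  refine (PosSemidef.diagonal ?_).add ((posSemidef_vecMulVec_self_star _).smul ?_)
  · intro i
    fin_cases i
    · simpa using (Complex.zero_le_real.mpr ht.le)
    · simp
  · exact_mod_cast (inv_pos.mpr h₂).le

lemma hasDerivAt_trace_mul_mfun_hermLine (S : Matrix (Fin 2) (Fin 2) ℂ) {y₁ y₂ : ℝ}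
    (hy : y₁ ≠ y₂) (a : ℝ) (z : ℂ) {f : ℝ → ℝ} {f₁ f₂ : ℝ} (hf₁ : HasDerivAt f f₁ y₁)
    (hf₂ : HasDerivAt f f₂ y₂) :
    HasDerivAt (fun t => (S * mfun f (hermLine y₁ y₂ a z t)).trace.re)
      ((S 0 0).re * (f₁ * a) +
        (f y₁ - f y₂) / (y₁ - y₂) * (S 0 1 * star z + S 1 0 * z).re) 0 := by
  have hD : y₁ - y₂ ≠ 0 := sub_ne_zero.mpr hy
  set D := y₁ - y₂ with hDdef
  set N := Complex.normSq z with hN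
  let e : ℝ → ℝ := fun t => D * Real.sqrt ((1 + t * a / D) ^ 2 + 4 * t ^ 2 * N / D ^ 2)
  have he0 : e 0 = D := by simp [e]
  have hesq (t : ℝ) : e t ^ 2 = (D + t * a) ^ 2 + 4 * t ^ 2 * N := by
    have hN0 : 0 ≤ N := Complex.normSq_nonneg z
    simp only [e, mul_pow]
    rw [Real.sq_sqrt (by positivity)]
    field_simp
  have hed : HasDerivAt e a 0 := by
    have h1 : HasDerivAt (fun t : ℝ => (1 + t * a / D) ^ 2 + 4 * t ^ 2 * N / D ^ 2)
        (2 * a / D) 0 := by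
      have h2 := ((((hasDerivAt_id (0 : ℝ)).mul_const a).div_const D).const_add 1).pow 2
      have h3 := ((((hasDerivAt_id (0 : ℝ)).pow 2).const_mul 4).mul_const N).div_const (D ^ 2)
      refine (h2.add h3).congr_deriv ?_
      simp
      ring
    refine ((h1.sqrt (by simp)).const_mul D).congr_deriv ?_
    simp
    field_simp
  let l : ℝ → ℝ := fun t => (y₁ + y₂ + t * a + e t) / 2
  let m : ℝ → ℝ := fun t => (y₁ + y₂ + t * a - e t) / 2
  have hl0 : l 0 = y₁ := by simp [l, he0, hDdef]
  have hm0 : m 0 = y₂ := by simp [m, he0, hDdef]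
  have hlin : HasDerivAt (fun t : ℝ => y₁ + y₂ + t * a) a 0 := by
    simpa using ((hasDerivAt_id (0 : ℝ)).mul_const a).const_add (y₁ + y₂)
  have hld : HasDerivAt l a 0 := ((hlin.add hed).div_const 2).congr_deriv (by ring)
  have hmd : HasDerivAt m 0 0 := ((hlin.sub hed).div_const 2).congr_deriv (by ring)
  have hfl : HasDerivAt (fun t => f (l t)) (f₁ * a) 0 := by
    have := hf₁
    rw [← hl0] at this
    exact this.comp 0 hld
  have hfm : HasDerivAt (fun t => f (m t)) 0 0 := by
    have := hf₂
    rw [← hm0] at this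
    exact (this.comp 0 hmd).congr_deriv (mul_zero f₂)
  let q : ℝ → ℝ := fun t => (f (l t) - f (m t)) / (l t - m t)
  have hq0 : q 0 = (f y₁ - f y₂) / D := by simp only [q, hl0, hm0, hDdef]
  have hqd : HasDerivAt q ((f₁ * a - q 0 * a) / D) 0 := by
    refine ((hfl.sub hfm).div (hld.sub hmd) (by simpa [hl0, hm0] using hD)).congr_deriv ?_
    simp only [Pi.sub_apply, hq0, hl0, hm0, ← hDdef]
    field_simp
    ring
  have hpd : HasDerivAt (fun t => f (m t) - q t * m t) (-((f₁ * a - q 0 * a) / D * y₂)) 0 := by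
    refine (hfm.sub (hqd.mul hmd)).congr_deriv ?_
    rw [hm0]; ring
  set s := (S 0 1 * star z + S 1 0 * z).re with hs
  have hrd : HasDerivAt (fun t : ℝ => (S 0 0).re * (y₁ + t * a) + t * s + (S 1 1).re * y₂)
      ((S 0 0).re * a + s) 0 := by
    have h2 := (((hasDerivAt_id (0 : ℝ)).mul_const a).const_add y₁).const_mul (S 0 0).re
    have h3 := (hasDerivAt_id (0 : ℝ)).mul_const s
    refine ((h2.add h3).add_const ((S 1 1).re * y₂)).congr_deriv (by simp)
  have htot := (hpd.mul_const ((S 0 0).re + (S 1 1).re)).add (hqd.mul hrd)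
  have hev : ∀ᶠ t in nhds (0 : ℝ), e t ≠ 0 :=
    hed.continuousAt.eventually_ne (by rw [he0]; exact hD)
  refine (htot.congr_of_eventuallyEq ?_).congr_deriv ?_
  · filter_upwards [hev] with t ht
    have hlm : l t ≠ m t := by
      intro h
      apply ht
      simp only [l, m] at h
      linarith
    have hsum : l t + m t = y₁ + t * a + y₂ := by simp only [l, m]; ring
    have hprod : l t * m t = (y₁ + t * a) * y₂ - t ^ 2 * N := by
      have := hesq t
      simp only [l, m]
      rw [hDdef] at this
      linear_combination (-1 / 4) * this
    have hsumC : (l t : ℂ) + m t = y₁ + t * a + y₂ := by exact_mod_cast hsum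
    have hprodC : (l t : ℂ) * m t = (y₁ + t * a) * y₂ - t ^ 2 * (star z * z) := by
      rw [Complex.star_def, ← Complex.normSq_eq_conj_mul_self]
      exact_mod_cast hprod
    have hzero : (hermLine y₁ y₂ a z t - (l t : ℂ) • 1) * (hermLine y₁ y₂ a z t - (m t : ℂ) • 1)
        = 0 := by
      ext i j
      fin_cases i <;> fin_cases j <;>
        simp [hermLine, Matrix.mul_apply, Fin.sum_univ_two] at hsumC hprodC ⊢
      · linear_combination (-(y₁ + t * a : ℂ)) * hsumC + hprodC
      · linear_combination (-(t * z : ℂ)) * hsumC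
      · linear_combination (-(t * (starRingEnd ℂ) z : ℂ)) * hsumC
      · linear_combination (-(y₂ : ℂ)) * hsumC + hprodC
    have hm := mfun_eq_of_mul_eq_zero (isHermitian_hermLine y₁ y₂ a z t) hlm hzero f
    change _ = ((f (m t) - q t * m t : ℝ) : ℂ) • 1 + (q t : ℂ) • _ at hm
    rw [hm]
    simp only [Pi.add_apply, Pi.mul_apply]
    generalize f (m t) - q t * m t = p
    generalize q t = r
    simp [hermLine, Matrix.trace_fin_two, Matrix.mul_apply, Fin.sum_univ_two, hs]
    ring
  · simp only [hq0, hDdef]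
    simp
    field_simp
    ring

lemma trace_mul_mfun_hermLine_zero (S : Matrix (Fin 2) (Fin 2) ℂ) {y₁ y₂ : ℝ} (hy : y₁ ≠ y₂)
    (a : ℝ) (z : ℂ) (f : ℝ → ℝ) :
    (S * mfun f (hermLine y₁ y₂ a z 0)).trace.re = (S 0 0).re * f y₁ + (S 1 1).re * f y₂ := by
  have hzero : (hermLine y₁ y₂ a z 0 - (y₁ : ℂ) • 1) * (hermLine y₁ y₂ a z 0 - (y₂ : ℂ) • 1)
      = 0 := by
    ext i j
    fin_cases i <;> fin_cases j <;> simp [hermLine, Matrix.mul_apply, Fin.sum_univ_two]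
  rw [mfun_eq_of_mul_eq_zero (isHermitian_hermLine y₁ y₂ a z 0) hy hzero]
  have hy' : y₁ - y₂ ≠ 0 := sub_ne_zero.mpr hy
  have hq : (f y₁ - f y₂) / (y₁ - y₂) * (y₁ - y₂) = f y₁ - f y₂ := div_mul_cancel₀ _ hy'
  generalize (f y₁ - f y₂) / (y₁ - y₂) = q at hq
  simp [hermLine, Matrix.trace_fin_two, Matrix.mul_apply, Fin.sum_univ_two]
  left
  linear_combination hq

/-- The off-diagonal divided difference of `x log x` exceeds its derivative at the
geometric mean. -/
lemma one_add_log_lt_divided_difference {u v : ℝ} (hu : 0 < u) (hv : 0 < v) (huv : u ≠ v) :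
    1 + (Real.log u + Real.log v) / 2 <
      (u * Real.log u - v * Real.log v) / (u - v) := by
  wlog h : v < u generalizing u v
  · have := this hv hu huv.symm (lt_of_le_of_ne (not_lt.mp h) huv)
    rw [← neg_div_neg_eq (u * _ - _), neg_sub, neg_sub, add_comm (Real.log u)]
    exact this
  have huv' : 0 < u - v := sub_pos.mpr h
  rw [lt_div_iff₀ huv']
  have h1 := Real.lt_log_one_add_of_pos (x := (u - v) / v) (by positivity)
  have h2 : 1 + (u - v) / v = u / v := by field_simp; ring
  have h3 : 2 * ((u - v) / v) / ((u - v) / v + 2) = 2 * (u - v) / (u + v) := by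
    field_simp
    ring
  rw [h2, h3, Real.log_div hu.ne' hv.ne', div_lt_iff₀ (by positivity)] at h1
  linarith

end TwoByTwo

lemma exists_unitary_mfun_eq {ι : Type*} [Fintype ι] [DecidableEq ι] {X : Matrix ι ι ℂ}
    (hX : X.PosDef) :
    ∃ (U : Matrix ι ι ℂ) (x : ι → ℝ), U * Uᴴ = 1 ∧ (∀ i, 0 < x i) ∧
      ∀ f : ℝ → ℝ, mfun f X = U * diagonal (fun i => (f (x i) : ℂ)) * Uᴴ := by
  refine ⟨hX.1.eigenvectorUnitary, hX.1.eigenvalues,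
    Unitary.mul_star_self_of_mem hX.1.eigenvectorUnitary.2, hX.eigenvalues_pos, fun f => ?_⟩
  rw [mfun, dif_pos hX.1, Matrix.IsHermitian.cfc, Unitary.conjStarAlgAut_apply]
  rfl

/-- Simultaneous diagonalization by congruence of two positive definite matrices, together with
their geometric means. -/
lemma exists_congruence_diagonal {ι : Type*} [Fintype ι] [DecidableEq ι] {ρ σ : Matrix ι ι ℂ}
    (hρ : ρ.PosDef) (hσ : σ.PosDef) :
    ∃ (K : Matrix ι ι ℂ) (x : ι → ℝ), IsUnit K ∧ (∀ i, 0 < x i) ∧ K * Kᴴ = σ ∧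
      K * diagonal (fun i => (x i : ℂ)) * Kᴴ = ρ ∧
      ∀ γ : ℝ, geomMean σ ρ γ = K * diagonal (fun i => ((x i ^ γ : ℝ) : ℂ)) * Kᴴ := by
  set R := mpow σ (1 / 2) with hR
  set Q := mpow σ (-(1 / 2)) with hQ
  have hRH : Rᴴ = R := isHermitian_mfun _ _
  have hQH : Qᴴ = Q := isHermitian_mfun _ _
  have hRR : R * R = σ := mpow_half_mul_self hσ.posSemidef
  have hRQ : R * Q = 1 := by rw [hR, hQ, mpow_mul_mpow hσ, add_neg_cancel, mpow_zero hσ]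
  have hQR : Q * R = 1 := by rw [hR, hQ, mpow_mul_mpow hσ, neg_add_cancel, mpow_zero hσ]
  have hRu : IsUnit R := IsUnit.of_mul_eq_one Q hRQ
  have hQu : IsUnit Q := IsUnit.of_mul_eq_one R hQR
  have hX : (Q * ρ * Q).PosDef := by
    simpa only [hQH] using
      hρ.mul_mul_conjTranspose_same (B := Q) (Matrix.vecMul_injective_iff_isUnit.mpr hQu)
  obtain ⟨U, x, hUU, hx, hf⟩ := exists_unitary_mfun_eq hX
  have hmf (f : ℝ → ℝ) : R * mfun f (Q * ρ * Q) * R =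
      R * U * diagonal (fun i => (f (x i) : ℂ)) * (R * U)ᴴ := by
    rw [hf, conjTranspose_mul, hRH]
    simp only [mul_assoc]
  refine ⟨R * U, x, hRu.mul (IsUnit.of_mul_eq_one _ hUU), hx, ?_, ?_, fun γ => hmf _⟩
  · rw [conjTranspose_mul, hRH, ← hRR]
    calc R * U * (Uᴴ * R) = R * (U * Uᴴ) * R := by simp only [mul_assoc]
      _ = R * R := by rw [hUU, mul_one]
  · rw [← hmf (fun x => x), mfun_id hX.1]
    calc R * (Q * ρ * Q) * R = (R * Q) * ρ * (Q * R) := by simp only [mul_assoc]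
      _ = ρ := by rw [hRQ, hQR, one_mul, mul_one]

lemma diagonal_mul_hermLine_mul_diagonal {d₁ d₂ : ℝ} (h₁ : 0 < d₁) (h₂ : 0 < d₂)
    (y₁ y₂ a : ℝ) (z : ℂ) (t : ℝ) :
    diagonal ![(d₁ : ℂ), d₂] *
      hermLine (y₁ / d₁ ^ 2) (y₂ / d₂ ^ 2) (a / d₁ ^ 2) (z / (d₁ * d₂ : ℝ)) t *
      diagonal ![(d₁ : ℂ), d₂] = hermLine y₁ y₂ a z t := by
  have h₁' : (d₁ : ℂ) ≠ 0 := by exact_mod_cast h₁.ne'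
  have h₂' : (d₂ : ℂ) ≠ 0 := by exact_mod_cast h₂.ne'
  ext i j
  fin_cases i <;> fin_cases j <;> simp [hermLine] <;> field_simp

/-- The geometric mean, normalized, attains the maximal Rényi value but is not stationary
for the barycentric variational problem. -/
lemma exists_state_lt {K : Matrix (Fin 2) (Fin 2) ℂ} (hK : IsUnit K) {x : Fin 2 → ℝ}
    (hx : ∀ i, 0 < x i) (hne : x 0 ≠ x 1) (hS : (Kᴴ * K) 0 1 ≠ 0) {α : ℝ}
    (hα : α ∈ Set.Ioo (0 : ℝ) 1) :
    ∃ ω : Matrix (Fin 2) (Fin 2) ℂ, ω.PosSemidef ∧ ω.trace = 1 ∧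
      α * Dmax ω (K * diagonal (fun i => (x i : ℂ)) * Kᴴ) + (1 - α) * Dmax ω (K * Kᴴ) <
        -Real.log (K * diagonal (fun i => ((x i ^ α : ℝ) : ℂ)) * Kᴴ).trace.re := by
  obtain ⟨hα0, hα1⟩ := hα
  have hSpd : (Kᴴ * K).PosDef := by
    simpa using Matrix.PosDef.one.conjTranspose_mul_mul_same
      (B := K) (Matrix.mulVec_injective_iff_isUnit.mpr hK)
  set S := Kᴴ * K with hSdef
  have hdiag (i : Fin 2) : 0 < (S i i).re ∧ S i i = ((S i i).re : ℂ) := by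
    have h := Complex.lt_def.mp (hSpd.diag_pos (i := i))
    exact ⟨h.1, Complex.ext rfl h.2.symm⟩
  have hS10 : S 1 0 = star (S 0 1) := (hSpd.1.apply 1 0).symm
  obtain ⟨hs₁, hs₁'⟩ := hdiag 0
  obtain ⟨hs₂, hs₂'⟩ := hdiag 1
  set s₁ := (S 0 0).re with hs₁def
  set s₂ := (S 1 1).re with hs₂def
  have hx₁ := hx 0
  have hx₂ := hx 1
  have htrace (M : Matrix (Fin 2) (Fin 2) ℂ) : (K * M * Kᴴ).trace = (S * M).trace := by
    rw [Matrix.trace_mul_comm, ← mul_assoc]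
  set g := (K * diagonal (fun i => ((x i ^ α : ℝ) : ℂ)) * Kᴴ).trace.re with hgdef
  have hg : g = s₁ * x 0 ^ α + s₂ * x 1 ^ α := by
    rw [hgdef, htrace, Matrix.trace_fin_two]
    simp [hs₁def, hs₂def]
  have hg0 : 0 < g := by rw [hg]; positivity
  set N := Complex.normSq (S 0 1) with hN
  have hN0 : 0 < N := Complex.normSq_pos.mpr hS
  have hoff : S 0 1 * star (-S 0 1) + S 1 0 * -S 0 1 = ((-(2 * N) : ℝ) : ℂ) := by
    rw [hS10]
    push_cast
    rw [hN, Complex.normSq_eq_conj_mul_self]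
    simp
    ring
  set a := 2 * N / s₁ with ha
  set y : Fin 2 → ℝ := fun i => x i ^ α / g with hy
  set w : Fin 2 → ℝ := fun i => y i / √(x i) ^ 2 with hw
  have hsq (i : Fin 2) : √(x i) ^ 2 = x i := Real.sq_sqrt (hx i).le
  have hy0 (i) : 0 < y i := by have := hx i; positivity
  have hw0 (i) : 0 < w i := by have := hx i; have := hy0 i; positivity
  have hlogy (i) : Real.log (y i) = α * Real.log (x i) - Real.log g := by
    rw [hy, Real.log_div (Real.rpow_pos_of_pos (hx i) α).ne' hg0.ne', Real.log_rpow (hx i)]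
  have hlogw (i) : Real.log (w i) = (α - 1) * Real.log (x i) - Real.log g := by
    simp only [hw, hsq]
    rw [Real.log_div (hy0 i).ne' (hx i).ne', hlogy]
    ring
  have hlogx : Real.log (x 0) ≠ Real.log (x 1) := fun h =>
    hne (Real.log_injOn_pos hx₁ hx₂ h)
  have hyne : y 0 ≠ y 1 := by
    intro h
    have h' := congrArg Real.log h
    rw [hlogy, hlogy] at h'
    exact hlogx (mul_left_cancel₀ hα0.ne' (by linarith))
  have hwne : w 0 ≠ w 1 := by
    intro h
    have h' := congrArg Real.log h
    rw [hlogw, hlogw] at h'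
    exact hlogx (mul_left_cancel₀ (sub_ne_zero.mpr hα1.ne) (by linarith))
  set D : Matrix (Fin 2) (Fin 2) ℂ := diagonal ![(√(x 0) : ℂ), √(x 1)] with hD
  have hsx₁ : 0 < √(x 0) := Real.sqrt_pos.mpr hx₁
  have hsx₂ : 0 < √(x 1) := Real.sqrt_pos.mpr hx₂
  have hDH : Dᴴ = D := by
    ext i j
    fin_cases i <;> fin_cases j <;> simp [hD]
  have hDD : D * D = diagonal (fun i => (x i : ℂ)) := by
    rw [hD, diagonal_mul_diagonal]
    congr 1
    ext i
    fin_cases i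
    · simpa [← pow_two] using congrArg Complex.ofReal (hsq 0)
    · simpa [← pow_two] using congrArg Complex.ofReal (hsq 1)
  have hDu : IsUnit D := by
    rw [Matrix.isUnit_iff_isUnit_det, hD, det_diagonal]
    simp [Fin.prod_univ_two, hsx₁.ne', hsx₂.ne']
  set z' : ℂ := -S 0 1 / (√(x 0) * √(x 1) : ℝ) with hz'
  set a' := a / √(x 0) ^ 2 with ha'
  let Y : ℝ → Matrix (Fin 2) (Fin 2) ℂ := hermLine (y 0) (y 1) a (-S 0 1)
  let W : ℝ → Matrix (Fin 2) (Fin 2) ℂ := hermLine (w 0) (w 1) a' z'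
  have hYW (t : ℝ) : D * W t * D = Y t :=
    diagonal_mul_hermLine_mul_diagonal hsx₁ hsx₂ (y 0) (y 1) a (-S 0 1) t
  let η : ℝ → ℝ := fun u => u * Real.log u
  have hη (u : ℝ) (hu : 0 < u) : HasDerivAt η (Real.log u + 1) u :=
    Real.hasDerivAt_mul_log hu.ne'
  let F : ℝ → ℝ := fun t => α * (D * S * D * mfun η (W t)).trace.re +
    (1 - α) * (S * mfun η (Y t)).trace.re
  have hDSD₀ : (D * S * D) 0 0 = ((x 0 * s₁ : ℝ) : ℂ) := by
    rw [← hsq 0]; simp [hD]; rw [hs₁']; ring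
  have hDSD₁ : (D * S * D) 1 1 = ((x 1 * s₂ : ℝ) : ℂ) := by
    rw [← hsq 1]; simp [hD]; rw [hs₂']; ring
  have hoff' : (D * S * D) 0 1 * star z' + (D * S * D) 1 0 * z' = ((-(2 * N) : ℝ) : ℂ) := by
    have h₁' : (√(x 0) : ℂ) ≠ 0 := by exact_mod_cast hsx₁.ne'
    have h₂' : (√(x 1) : ℂ) ≠ 0 := by exact_mod_cast hsx₂.ne'
    rw [← hoff, hz']
    simp [hD]
    field_simp
  have hF0 : F 0 = -Real.log g := by
    have h₁ : w 0 * x 0 = y 0 := by simp only [hw, hsq]; field_simp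
    have h₂ : w 1 * x 1 = y 1 := by simp only [hw, hsq]; field_simp
    have h₃ : s₁ * y 0 + s₂ * y 1 = 1 := by
      simp only [hy]; rw [hg] at hg0 ⊢; field_simp
    simp only [F, W, Y, trace_mul_mfun_hermLine_zero _ hwne, trace_mul_mfun_hermLine_zero _ hyne,
      hDSD₀, hDSD₁, Complex.ofReal_re, η, hlogy, hlogw, ← hs₁def, ← hs₂def]
    linear_combination (α * s₁ * ((α - 1) * Real.log (x 0) - Real.log g)) * h₁ +
      (α * s₂ * ((α - 1) * Real.log (x 1) - Real.log g)) * h₂ - Real.log g * h₃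
  have hFd := ((hasDerivAt_trace_mul_mfun_hermLine (D * S * D) hwne a' z' (hη _ (hw0 0))
    (hη _ (hw0 1))).const_mul α).add ((hasDerivAt_trace_mul_mfun_hermLine S hyne a (-S 0 1)
    (hη _ (hy0 0)) (hη _ (hy0 1))).const_mul (1 - α))
  change HasDerivAt F _ 0 at hFd
  by_contra! hcon
  have hmin : IsLocalMin F 0 := by
    filter_upwards [eventually_posSemidef_hermLine (hy0 0) (hy0 1) a (-S 0 1),
      eventually_posSemidef_hermLine (hw0 0) (hw0 1) a' z'] with t hYt hWt
    change (Y t).PosSemidef at hYt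
    change (W t).PosSemidef at hWt
    have hω₁ := Dmax_congruence hK hYt
    have hω₂ := Dmax_congruence (hK.mul hDu) hWt
    have e₁ : K * D * W t * (K * D)ᴴ = K * Y t * Kᴴ := by
      rw [conjTranspose_mul, hDH, ← hYW]; simp only [mul_assoc]
    have e₂ : K * D * (K * D)ᴴ = K * diagonal (fun i => (x i : ℂ)) * Kᴴ := by
      rw [conjTranspose_mul, hDH, ← hDD]; simp only [mul_assoc]
    have e₃ : (K * D)ᴴ * (K * D) = D * S * D := by
      rw [conjTranspose_mul, hDH, hSdef]; simp only [mul_assoc]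
    rw [e₁, e₂, e₃] at hω₂
    have htr : (K * Y t * Kᴴ).trace = 1 := by
      rw [htrace]
      have h₃ : s₁ * y 0 + s₂ * y 1 = 1 := by
        simp only [hy]; rw [hg] at hg0 ⊢; field_simp
      have h₃' : (s₁ : ℂ) * y 0 + s₂ * y 1 = 1 := by exact_mod_cast h₃
      have h₄ : (s₁ : ℂ) * a = 2 * N := by
        have : s₁ * a = 2 * N := by rw [ha]; field_simp
        exact_mod_cast this
      have h₅ := hoff
      push_cast at h₅
      simp only [Y, hermLine, Matrix.trace_fin_two, Matrix.mul_apply, Fin.sum_univ_two]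
      simp only [of_apply, cons_val', cons_val_zero, cons_val_one, cons_val_fin_one]
      rw [hs₁', hs₂']
      push_cast
      linear_combination h₃' + (t : ℂ) * h₄ + (t : ℂ) * h₅
    have h := hcon _ (hYt.mul_mul_conjTranspose_same K) htr
    rw [hω₁, hω₂] at h
    rw [hF0]
    exact h
  have hzero := hmin.hasDerivAt_eq_zero hFd
  rw [hoff, hoff', hDSD₀] at hzero
  simp only [Complex.ofReal_re, ← hs₁def] at hzero
  have hcy := one_add_log_lt_divided_difference (hy0 0) (hy0 1) hyne
  have hcw := one_add_log_lt_divided_difference (hw0 0) (hw0 1) hwne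
  have h₄ : s₁ * a = 2 * N := by rw [ha]; field_simp
  have h₅ : x 0 * a' = a := by rw [ha', hsq]; field_simp
  change α * (x 0 * s₁ * ((Real.log (w 0) + 1) * a') +
    (w 0 * Real.log (w 0) - w 1 * Real.log (w 1)) / (w 0 - w 1) * -(2 * N)) +
    (1 - α) * (s₁ * ((Real.log (y 0) + 1) * a) +
    (y 0 * Real.log (y 0) - y 1 * Real.log (y 1)) / (y 0 - y 1) * -(2 * N)) = 0 at hzero
  generalize (w 0 * Real.log (w 0) - w 1 * Real.log (w 1)) / (w 0 - w 1) = qw at hzero hcw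
  generalize (y 0 * Real.log (y 0) - y 1 * Real.log (y 1)) / (y 0 - y 1) = qy at hzero hcy
  rw [hlogy, hlogy] at hcy
  rw [hlogw, hlogw] at hcw
  rw [hlogw, hlogy] at hzero
  have hzero' : 2 * N * (1 - Real.log g - (α * qw + (1 - α) * qy)) = 0 := by
    linear_combination hzero - (α * s₁ * ((α - 1) * Real.log (x 0) - Real.log g + 1)) * h₅ -
      (1 - Real.log g) * h₄
  have hc := mul_lt_mul_of_pos_left hcw hα0
  have hc' := mul_lt_mul_of_pos_left hcy (sub_pos.mpr hα1)
  rcases mul_eq_zero.mp hzero' with h | h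
  · linarith
  · nlinarith

/-- **On noncommuting positive definite `2×2` pairs, the barycentric maximal Rényi divergence
is strictly smaller than the maximal Rényi divergence.** For positive definite `2×2` matrices
`ρ, σ` with `ρσ ≠ σρ` and `α ∈ (0,1)`:
`inf { α·D^max(ω‖ρ) + (1−α)·D^max(ω‖σ) : ω a state } < − log Tr(σ #_α ρ)`;
in particular there exists a state `ω` with
`α·D^max(ω‖ρ) + (1−α)·D^max(ω‖σ) < − log Tr(σ #_α ρ)`. -/
theorem barycentric_max_lt_max_Renyi_two_dim
    (ρ σ : Matrix (Fin 2) (Fin 2) ℂ) (hρ : ρ.PosDef) (hσ : σ.PosDef)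
    (hc : ρ * σ ≠ σ * ρ) (α : ℝ) (hα : α ∈ Set.Ioo (0 : ℝ) 1) :
    (sInf {r : ℝ | ∃ ω : Matrix (Fin 2) (Fin 2) ℂ,
        ω.PosSemidef ∧ ω.trace = 1 ∧ r = α * Dmax ω ρ + (1 - α) * Dmax ω σ}
      < - Real.log (((geomMean σ ρ α).trace).re))
    ∧ ∃ ω : Matrix (Fin 2) (Fin 2) ℂ, ω.PosSemidef ∧ ω.trace = 1 ∧
        α * Dmax ω ρ + (1 - α) * Dmax ω σ < - Real.log (((geomMean σ ρ α).trace).re) := by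
  obtain ⟨K, x, hK, hx, hKσ, hKρ, hG⟩ := exists_congruence_diagonal hρ hσ
  have hLS : diagonal (fun i => (x i : ℂ)) * (Kᴴ * K) ≠
      (Kᴴ * K) * diagonal (fun i => (x i : ℂ)) := by
    intro h
    apply hc
    rw [← hKσ, ← hKρ]
    calc K * diagonal (fun i => (x i : ℂ)) * Kᴴ * (K * Kᴴ)
        = K * (diagonal (fun i => (x i : ℂ)) * (Kᴴ * K)) * Kᴴ := by simp only [mul_assoc]
      _ = K * Kᴴ * (K * diagonal (fun i => (x i : ℂ)) * Kᴴ) := by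
        rw [h]; simp only [mul_assoc]
  have hne : x 0 ≠ x 1 := by
    intro h
    apply hLS
    ext i j
    rw [diagonal_mul, mul_diagonal]
    fin_cases i <;> fin_cases j <;> simp [h, mul_comm]
  have hS : (Kᴴ * K) 0 1 ≠ 0 := by
    intro h
    have h' : (Kᴴ * K) 1 0 = 0 := by
      rw [← (isHermitian_conjTranspose_mul_self K).apply 1 0, h, star_zero]
    apply hLS
    ext i j
    rw [diagonal_mul, mul_diagonal]
    fin_cases i <;> fin_cases j <;> simp [h, h', mul_comm]
  obtain ⟨ω, hω, hωtr, hlt⟩ := exists_state_lt hK hx hne hS hα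
  rw [hKσ, hKρ, ← hG] at hlt
  refine ⟨lt_of_le_of_lt (csInf_le ?_ ⟨ω, hω, hωtr, rfl⟩) hlt, ω, hω, hωtr, hlt⟩
  refine ⟨α * -ρ.trace.re + (1 - α) * -σ.trace.re, ?_⟩
  rintro r ⟨ω', hω', -, rfl⟩
  have h₁ := mul_le_mul_of_nonneg_left (neg_trace_le_Dmax hω' hρ) hα.1.le
  have h₂ := mul_le_mul_of_nonneg_left (neg_trace_le_Dmax hω' hσ) (sub_nonneg.mpr hα.2.le)
  exact add_le_add h₁ h₂
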